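/- arXiv:1401.3522 — 2 statements merged into one kernel-verified Lean document; each statement's English description precedes it below -/
import Mathlib

section
/- If A₁ and A₂ are two path cycles with A₁ ∩ A₂ ≠ ∅, then either A₁ ⊆ A₂ or A₂ ⊆ A₁. -/
open scoped ENNReal

namespace MetropolisCycles

variable {S : Type*} [Fintype S] [DecidableEq S]

/-- A path: a finite sequence of states whose consecutive members communicate. -/
def IsPath (q : S → S → ℝ) (ω : List S) : Prop :=
  ω.Chain' (fun a b => 0 < q a b)

/-- `x` and `y` are joined by a path entirely contained in `G`. -/
def JoinedIn (q : S → S → ℝ) (G : Set S) (x y : S) : Prop :=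
  ∃ ω : List S, ω.head? = some x ∧ ω.getLast? = some y ∧ IsPath q ω ∧ ∀ z ∈ ω, z ∈ G

/-- `G` is connected: any two of its points are joined by a path inside `G`. -/
def IsConnectedSet (q : S → S → ℝ) (G : Set S) : Prop :=
  ∀ x ∈ G, ∀ y ∈ G, JoinedIn q G x y

/-- The exterior boundary `∂G`. -/
def extBoundary (q : S → S → ℝ) (G : Set S) : Set S :=
  {y | y ∉ G ∧ ∃ x ∈ G, 0 < q x y}

/-- `A` is a non-trivial path cycle: connected and `max_A H < min_{∂A} H`. -/
def IsNontrivialPathCycle (H : S → ℝ) (q : S → S → ℝ) (A : Set S) : Prop :=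
  A.Nonempty ∧ IsConnectedSet q A ∧ ∀ x ∈ A, ∀ y ∈ extBoundary q A, H x < H y

/-- `A` is a path cycle: a singleton or a non-trivial path cycle. -/
def IsPathCycle (H : S → ℝ) (q : S → S → ℝ) (A : Set S) : Prop :=
  (∃ x, A = {x}) ∨ IsNontrivialPathCycle H q A

/-- The set of points joined to `x` by a path whose points all have energy at most `c`. -/
def energyCut (H : S → ℝ) (q : S → S → ℝ) (c : ℝ) (x : S) : Set S :=
  {y | JoinedIn q {z | H z ≤ c} x y}

/-- `U_{≤ x}`: the points joined to `x` by a path with energies at most `H x`. -/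
def Ule (H : S → ℝ) (q : S → S → ℝ) (x : S) : Set S := energyCut H q (H x) x

/-- A path starting in `B` and ending outside `B` visits the exterior boundary of `B`. -/
theorem exists_mem_extBoundary_of_isPath {S : Type*} (q : S → S → ℝ) (B : Set S) :
    ∀ (ω : List S) (x y : S), ω.head? = some x → ω.getLast? = some y → IsPath q ω →
      x ∈ B → y ∉ B → ∃ z ∈ ω, z ∈ extBoundary q B
  | [], _, _, hx, _, _, _, _ => by simp at hx
  | [a], x, y, hx, hy, _, hxB, hyB => by
    simp only [List.head?_cons, List.getLast?_singleton, Option.some.injEq] at hx hy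
    subst hx hy
    exact absurd hxB hyB
  | a :: b :: l, x, y, hx, hy, hω, hxB, hyB => by
    simp only [List.head?_cons, Option.some.injEq] at hx
    subst hx
    obtain ⟨hab, hl⟩ := List.isChain_cons_cons.mp hω
    by_cases hb : b ∈ B
    · obtain ⟨z, hz, hzB⟩ := exists_mem_extBoundary_of_isPath q B (b :: l) b y rfl
        (by simpa only [List.getLast?_cons_cons] using hy) hl hb hyB
      exact ⟨z, List.mem_cons_of_mem _ hz, hzB⟩
    · exact ⟨b, by simp, hb, a, hxB, hab⟩

/-- A connected set meeting both `B` and its complement meets the exterior boundary of `B`. -/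
theorem IsConnectedSet.exists_mem_extBoundary {S : Type*} {q : S → S → ℝ} {A B : Set S}
    (hA : IsConnectedSet q A) (hAB : (A ∩ B).Nonempty) (hnot : ¬ A ⊆ B) :
    ∃ z ∈ A, z ∈ extBoundary q B := by
  obtain ⟨x, hxA, hxB⟩ := hAB
  obtain ⟨y, hyA, hyB⟩ := Set.not_subset.mp hnot
  obtain ⟨ω, hx, hy, hω, hmem⟩ := hA x hxA y hyA
  obtain ⟨z, hz, hzB⟩ := exists_mem_extBoundary_of_isPath q B ω x y hx hy hω hxB hyB
  exact ⟨z, hmem z hz, hzB⟩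

/-- Two path cycles with nonempty intersection are nested. -/
theorem pathCycles_nested (H : S → ℝ) (q : S → S → ℝ)
    (hq : ∀ x y : S, 0 ≤ q x y ∧ q x y ≤ 1)
    (hsum : ∀ x : S, ∑ y ∈ Finset.univ.erase x, q x y ≤ 1)
    (hsym : ∀ x y : S, q x y = q y x)
    (hirr : ∀ x y : S, JoinedIn q Set.univ x y)
    (A₁ A₂ : Set S) (h₁ : IsPathCycle H q A₁) (h₂ : IsPathCycle H q A₂)
    (hint : (A₁ ∩ A₂).Nonempty) :
    A₁ ⊆ A₂ ∨ A₂ ⊆ A₁ := by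
  rcases h₁ with ⟨x, rfl⟩ | ⟨-, hc₁, hH₁⟩
  · exact Or.inl (Set.singleton_subset_iff.mpr (Set.singleton_inter_nonempty.mp hint))
  rcases h₂ with ⟨x, rfl⟩ | ⟨-, hc₂, hH₂⟩
  · exact Or.inr (Set.singleton_subset_iff.mpr (Set.inter_singleton_nonempty.mp hint))
  by_contra! hnot
  obtain ⟨y, hy₁, hy₂⟩ := hc₁.exists_mem_extBoundary hint hnot.1
  obtain ⟨z, hz₂, hz₁⟩ := hc₂.exists_mem_extBoundary (Set.inter_comm A₁ A₂ ▸ hint) hnot.2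
  exact lt_asymm (hH₁ y hy₁ z hz₁) (hH₂ z hz₂ y hy₂)

end MetropolisCycles
end

section
/- Let A be a non-trivial path cycle and let ε > 0. Then for every x, x' ∈ A, the probability ℙ_x[ τ_{x'} < τ_{∂A} and τ_{x'} < exp(β(Γ̃(A)+ε)) ] tends to 1 as β → ∞, where Γ̃(A) := max_A H − min_A H is the resistance height of A and τ_{x'} := τ_{{x'}}. -/
open scoped ENNReal

namespace MetropolisCycles

variable {S : Type*} [Fintype S] [DecidableEq S]

/-- The Metropolis transition kernel `p_β`. -/
noncomputable def pMet (H : S → ℝ) (q : S → S → ℝ) (β : ℝ) (x y : S) : ℝ :=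
  if x = y then 1 - ∑ z ∈ Finset.univ.erase x, q x z * Real.exp (-(β * max (H z - H x) 0))
  else q x y * Real.exp (-(β * max (H y - H x) 0))

/-- The trajectory started at `x` whose `n` first steps are given by `f`
(frozen after time `n`). -/
def trajFun (x : S) {n : ℕ} (f : Fin n → S) : ℕ → S := fun t =>
  if h : min t n = 0 then x else f ⟨min t n - 1, by omega⟩

/-- The probability weight of the finite trajectory `x, f 0, …, f (n-1)`. -/
noncomputable def trajWeight (H : S → ℝ) (q : S → S → ℝ) (β : ℝ) (x : S) {n : ℕ}
    (f : Fin n → S) : ℝ :=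
  ∏ t ∈ Finset.range n, pMet H q β (trajFun x f t) (trajFun x f (t + 1))

open scoped Classical in
/-- `ℙ_x[Ev]` for an event `Ev` determined by the trajectory up to time `n`. -/
noncomputable def ProbX (H : S → ℝ) (q : S → S → ℝ) (β : ℝ) (x : S) (n : ℕ)
    (Ev : (ℕ → S) → Prop) : ℝ :=
  ∑ f : Fin n → S, if Ev (trajFun x f) then trajWeight H q β x f else 0

/-- The hitting time `τ_G` of `G`, with value `⊤` if `G` is never visited. -/
noncomputable def hitTime (G : Set S) (ω : ℕ → S) : ℕ∞ :=
  ⨅ t ∈ {t : ℕ | ω t ∈ G}, (t : ℕ∞)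

/-- The depth `Γ(A) = min_{∂A} H - min_A H` of a cycle. -/
noncomputable def cycleDepth (H : S → ℝ) (q : S → S → ℝ) (A : Set S) : ℝ :=
  sInf (H '' extBoundary q A) - sInf (H '' A)

/-- The resistance height `Γ̃(A) = max_A H - min_A H` of a cycle. -/
noncomputable def cycleRes (H : S → ℝ) (A : Set S) : ℝ :=
  sSup (H '' A) - sInf (H '' A)

/-- `a` is visited at a time smaller than `N`, and `D` is not visited up to that time. -/
def VisitsBefore (a : S) (D : Set S) (N : ℕ) (ω : ℕ → S) : Prop :=
  ∃ t < N, ω t = a ∧ ∀ s ≤ t, ω s ∉ D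

omit [Fintype S] [DecidableEq S] in
theorem hitTime_le {G : Set S} {ω : ℕ → S} {t : ℕ} (h : ω t ∈ G) : hitTime G ω ≤ t :=
  iInf₂_le t h

omit [Fintype S] [DecidableEq S] in
theorem hitTime_lt_iff {G : Set S} {ω : ℕ → S} {a : ℕ∞} :
    hitTime G ω < a ↔ ∃ t : ℕ, ω t ∈ G ∧ (t : ℕ∞) < a := by
  simp [hitTime, iInf_lt_iff]

omit [Fintype S] [DecidableEq S] in
theorem hitTime_event_iff (a : S) (D : Set S) (r : ℝ) (ω : ℕ → S) :
    (hitTime ({a} : Set S) ω < hitTime D ω ∧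
      ∃ t : ℕ, hitTime ({a} : Set S) ω = (t : ℕ∞) ∧ (t : ℝ) < r) ↔
      VisitsBefore a D ⌈r⌉₊ ω := by
  constructor
  · rintro ⟨hlt, t, ht, htr⟩
    have h1 : hitTime ({a} : Set S) ω < ((t + 1 : ℕ) : ℕ∞) := by
      rw [ht]; exact_mod_cast Nat.lt_succ_self t
    obtain ⟨s, hs, hst⟩ := hitTime_lt_iff.1 h1
    have hst' : s ≤ t := Nat.lt_succ_iff.1 (by exact_mod_cast hst)
    refine ⟨s, lt_of_le_of_lt hst' (Nat.lt_ceil.2 htr), hs, fun u hu hD => ?_⟩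
    have h2 : hitTime D ω ≤ t :=
      (hitTime_le hD).trans (by exact_mod_cast hu.trans hst')
    rw [ht] at hlt
    exact absurd h2 (not_le.2 hlt)
  · rintro ⟨t, htN, hta, hD⟩
    have hle : hitTime ({a} : Set S) ω ≤ t := hitTime_le hta
    obtain ⟨k, hk⟩ := ENat.ne_top_iff_exists.1 (ne_top_of_le_ne_top (ENat.natCast_ne_top t) hle)
    have hkt : k ≤ t := by rw [← hk] at hle; exact_mod_cast hle
    refine ⟨lt_of_le_of_lt hle ?_, k, hk.symm, ?_⟩
    · have h1 : ((t + 1 : ℕ) : ℕ∞) ≤ hitTime D ω := by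
        refine le_iInf₂ fun u hu => ?_
        by_contra hcon
        have : u < t + 1 := by exact_mod_cast not_le.1 hcon
        exact hD u (by omega) hu
      exact lt_of_lt_of_le (by exact_mod_cast Nat.lt_succ_self t) h1
    · exact lt_of_le_of_lt (by exact_mod_cast hkt) (Nat.lt_ceil.1 htN)

omit [Fintype S] [DecidableEq S] in
theorem trajFun_zero (x : S) {n : ℕ} (f : Fin n → S) : trajFun x f 0 = x := by
  simp [trajFun]

omit [Fintype S] [DecidableEq S] in
theorem trajFun_cons_succ (x y : S) {n : ℕ} (f : Fin n → S) (t : ℕ) :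
    trajFun x (Fin.cons y f : Fin (n + 1) → S) (t + 1) = trajFun y f t := by
  have h0 : min (t + 1) (n + 1) ≠ 0 := by omega
  unfold trajFun
  rw [dif_neg h0]
  by_cases h : min t n = 0
  · rw [dif_pos h]
    have : (⟨min (t + 1) (n + 1) - 1, by omega⟩ : Fin (n + 1)) = 0 := by
      apply Fin.ext; simp; omega
    rw [this, Fin.cons_zero]
  · rw [dif_neg h]
    have : (⟨min (t + 1) (n + 1) - 1, by omega⟩ : Fin (n + 1))
        = Fin.succ ⟨min t n - 1, by omega⟩ := by
      apply Fin.ext; simp; omega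
    rw [this, Fin.cons_succ]

theorem trajWeight_cons (H : S → ℝ) (q : S → S → ℝ) (β : ℝ) (x y : S) {n : ℕ} (f : Fin n → S) :
    trajWeight H q β x (Fin.cons y f : Fin (n + 1) → S)
      = pMet H q β x y * trajWeight H q β y f := by
  unfold trajWeight
  rw [Finset.prod_range_succ', mul_comm]
  simp only [trajFun_cons_succ, trajFun_zero]

/-- The Markov property at time one. -/
theorem ProbX_succ (H : S → ℝ) (q : S → S → ℝ) (β : ℝ) (x : S) (n : ℕ)
    (Ev Ev' : (ℕ → S) → Prop)
    (h : ∀ (y : S) (f : Fin n → S),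
      Ev (trajFun x (Fin.cons y f : Fin (n + 1) → S)) ↔ Ev' (trajFun y f)) :
    ProbX H q β x (n + 1) Ev = ∑ y, pMet H q β x y * ProbX H q β y n Ev' := by
  classical
  unfold ProbX
  rw [← (Fin.consEquiv fun _ => S).sum_comp, Fintype.sum_prod_type]
  refine Finset.sum_congr rfl fun y _ => ?_
  rw [Finset.mul_sum]
  refine Finset.sum_congr rfl fun f _ => ?_
  change (if Ev (trajFun x (Fin.cons y f : Fin (n + 1) → S)) then
    trajWeight H q β x (Fin.cons y f : Fin (n + 1) → S) else 0) = _
  simp only [h, trajWeight_cons, mul_ite, mul_zero]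

theorem ProbX_congr (H : S → ℝ) (q : S → S → ℝ) (β : ℝ) (x : S) (n : ℕ)
    {Ev Ev' : (ℕ → S) → Prop} (h : ∀ f : Fin n → S, Ev (trajFun x f) ↔ Ev' (trajFun x f)) :
    ProbX H q β x n Ev = ProbX H q β x n Ev' := by
  classical
  unfold ProbX
  exact Finset.sum_congr rfl fun f _ => if_congr (h f) rfl rfl

theorem sum_pMet (H : S → ℝ) (q : S → S → ℝ) (β : ℝ) (x : S) : ∑ y, pMet H q β x y = 1 := by
  rw [← Finset.add_sum_erase _ _ (Finset.mem_univ x)]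
  have : ∑ y ∈ Finset.univ.erase x, pMet H q β x y
      = ∑ z ∈ Finset.univ.erase x, q x z * Real.exp (-(β * max (H z - H x) 0)) := by
    refine Finset.sum_congr rfl fun y hy => ?_
    rw [pMet, if_neg (Finset.ne_of_mem_erase hy).symm]
  rw [this, pMet, if_pos rfl]
  ring

theorem pMet_nonneg {H : S → ℝ} {q : S → S → ℝ} {β : ℝ} (hβ : 0 ≤ β)
    (hq : ∀ x y : S, 0 ≤ q x y) (hsum : ∀ x : S, ∑ y ∈ Finset.univ.erase x, q x y ≤ 1)
    (x y : S) : 0 ≤ pMet H q β x y := by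
  unfold pMet
  split_ifs
  · refine sub_nonneg.2 (le_trans (Finset.sum_le_sum fun z _ => ?_) (hsum x))
    refine mul_le_of_le_one_right (hq x z) (Real.exp_le_one_iff.2 ?_)
    exact neg_nonpos.2 (mul_nonneg hβ (le_max_right _ _))
  · exact mul_nonneg (hq x y) (Real.exp_pos _).le

theorem exp_mul_pMet (H : S → ℝ) (q : S → S → ℝ) (β : ℝ) {x y : S} (hxy : x ≠ y) :
    Real.exp (-(β * H x)) * pMet H q β x y = q x y * Real.exp (-(β * max (H x) (H y))) := by
  have : max (H x) (H y) = H x + max (H y - H x) 0 := by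
    rw [← max_add_add_left]; simp [max_comm]
  rw [pMet, if_neg hxy, this, mul_left_comm, ← Real.exp_add]
  ring_nf

/-- Detailed balance. -/
theorem exp_mul_pMet_comm (H : S → ℝ) (q : S → S → ℝ) (β : ℝ) (hsym : ∀ x y, q x y = q y x)
    (x y : S) :
    Real.exp (-(β * H x)) * pMet H q β x y = Real.exp (-(β * H y)) * pMet H q β y x := by
  by_cases hxy : x = y
  · rw [hxy]
  · rw [exp_mul_pMet H q β hxy, exp_mul_pMet H q β (Ne.symm hxy), hsym, max_comm]

theorem ProbX_true (H : S → ℝ) (q : S → S → ℝ) (β : ℝ) (x : S) (n : ℕ) :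
    ProbX H q β x n (fun _ => True) = 1 := by
  induction n generalizing x with
  | zero => simp [ProbX, trajWeight]
  | succ n ih =>
    rw [ProbX_succ H q β x n _ (fun _ => True) (fun _ _ => Iff.rfl)]
    simp only [ih, mul_one, sum_pMet]

theorem ProbX_nonneg {H : S → ℝ} {q : S → S → ℝ} {β : ℝ} (hp : ∀ x y, 0 ≤ pMet H q β x y)
    (x : S) (n : ℕ) (Ev : (ℕ → S) → Prop) : 0 ≤ ProbX H q β x n Ev := by
  unfold ProbX
  refine Finset.sum_nonneg fun f _ => ?_
  split_ifs
  · exact Finset.prod_nonneg fun t _ => hp _ _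
  · exact le_rfl

theorem ProbX_le_one {H : S → ℝ} {q : S → S → ℝ} {β : ℝ} (hp : ∀ x y, 0 ≤ pMet H q β x y)
    (x : S) (n : ℕ) (Ev : (ℕ → S) → Prop) : ProbX H q β x n Ev ≤ 1 := by
  rw [← ProbX_true H q β x n]
  unfold ProbX
  refine Finset.sum_le_sum fun f _ => ?_
  have : 0 ≤ trajWeight H q β x f := Finset.prod_nonneg fun t _ => hp _ _
  split_ifs <;> simp_all

open scoped Classical in
/-- The kernel `P` killed upon leaving `B`. -/
noncomputable def killed (P : S → S → ℝ) (B : Set S) : Matrix S S ℝ :=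
  Matrix.of fun y z => if y ∈ B ∧ z ∈ B then P y z else 0

/-- The Green function `∑_{t < n} Q ^ t` of a matrix `Q`, up to time `n`. -/
noncomputable def green (Q : Matrix S S ℝ) (n : ℕ) : Matrix S S ℝ :=
  ∑ t ∈ Finset.range n, Q ^ t

omit [Fintype S] [DecidableEq S] in
theorem killed_nonneg {P : S → S → ℝ} (hP : ∀ x y, 0 ≤ P x y) (B : Set S) (x y : S) :
    0 ≤ killed P B x y := by
  simp only [killed, Matrix.of_apply]
  split_ifs
  · exact hP x y
  · exact le_rfl

theorem pow_apply_nonneg {Q : Matrix S S ℝ} (hQ : ∀ x y, 0 ≤ Q x y) (t : ℕ) (x y : S) :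
    0 ≤ (Q ^ t) x y := by
  induction t generalizing y with
  | zero => rw [pow_zero, Matrix.one_apply]; split_ifs <;> norm_num
  | succ t ih =>
    rw [pow_succ, Matrix.mul_apply]
    exact Finset.sum_nonneg fun z _ => mul_nonneg (ih z) (hQ z y)

theorem green_apply (Q : Matrix S S ℝ) (n : ℕ) (x y : S) :
    green Q n x y = ∑ t ∈ Finset.range n, (Q ^ t) x y := by
  rw [green, Matrix.sum_apply]

theorem green_nonneg {Q : Matrix S S ℝ} (hQ : ∀ x y, 0 ≤ Q x y) (n : ℕ) (x y : S) :
    0 ≤ green Q n x y := by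
  rw [green_apply]
  exact Finset.sum_nonneg fun t _ => pow_apply_nonneg hQ t x y

theorem green_le_succ {Q : Matrix S S ℝ} (hQ : ∀ x y, 0 ≤ Q x y) (n : ℕ) (x y : S) :
    green Q n x y ≤ green Q (n + 1) x y := by
  rw [green_apply, green_apply, Finset.sum_range_succ]
  exact le_add_of_nonneg_right (pow_apply_nonneg hQ n x y)

theorem green_mul_add_one (Q : Matrix S S ℝ) (n : ℕ) : green Q n * Q + 1 = green Q n + Q ^ n := by
  rw [green, ← Finset.sum_range_succ, Finset.sum_range_succ', Finset.sum_mul, pow_zero]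
  simp only [pow_succ]

theorem green_succ_eq (Q : Matrix S S ℝ) (n : ℕ) : green Q (n + 1) = Q * green Q n + 1 := by
  rw [green, green, Finset.sum_range_succ', Finset.mul_sum, pow_zero]
  simp only [pow_succ']

theorem green_killed_eq_zero (P : S → S → ℝ) {B : Set S} (n : ℕ) {x y : S} (hx : x ∈ B)
    (hy : y ∉ B) : green (killed P B) n x y = 0 := by
  rw [green_apply]
  refine Finset.sum_eq_zero fun t _ => ?_
  cases t with
  | zero =>
    rw [pow_zero, Matrix.one_apply, if_neg]
    rintro rfl
    exact hy hx
  | succ t =>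
    rw [pow_succ, Matrix.mul_apply]
    exact Finset.sum_eq_zero fun z _ => by simp [killed, hy]

/-- For a substochastic matrix, survival up to time `n` is at most the expected lifetime divided
by `n + 1`. -/
theorem mul_sum_pow_le_sum_green {Q : Matrix S S ℝ} (hQ : ∀ x y, 0 ≤ Q x y)
    (hQ1 : ∀ x, ∑ y, Q x y ≤ 1) (n : ℕ) (x : S) :
    ((n : ℝ) + 1) * ∑ y, (Q ^ n) x y ≤ ∑ y, green Q (n + 1) x y := by
  have hanti : Antitone fun t : ℕ => ∑ y, (Q ^ t) x y := by
    refine antitone_nat_of_succ_le fun t => ?_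
    simp only [pow_succ, Matrix.mul_apply]
    rw [Finset.sum_comm]
    refine Finset.sum_le_sum fun z _ => ?_
    rw [← Finset.mul_sum]
    exact mul_le_of_le_one_right (pow_apply_nonneg hQ t x z) (hQ1 z)
  simp only [green_apply]
  rw [Finset.sum_comm]
  have h := Finset.card_nsmul_le_sum (Finset.range (n + 1)) (fun t => ∑ y, (Q ^ t) x y)
    (∑ y, (Q ^ n) x y) fun t ht => hanti (Nat.lt_succ_iff.1 (Finset.mem_range.1 ht))
  simpa using h

omit [DecidableEq S] in
/-- The Dirichlet form dominates the contribution of each edge. -/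
theorem conductance_mul_sq_le (c : S → S → ℝ) (hc : ∀ x y, 0 ≤ c x y)
    (hsym : ∀ x y, c x y = c y x) (g : S → ℝ) (a b : S) :
    c a b * (g a - g b) ^ 2 ≤ 2 * ∑ y, g y * ∑ z, c y z * (g y - g z) := by
  have h1 : ∑ y, g y * ∑ z, c y z * (g y - g z)
      = ∑ y, ∑ z, g y * (c y z * (g y - g z)) := by simp only [Finset.mul_sum]
  have h2 : ∑ y, ∑ z, g y * (c y z * (g y - g z)) = ∑ y, ∑ z, g z * (c y z * (g z - g y)) := by
    rw [Finset.sum_comm]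
    simp only [hsym]
  have h3 : 2 * ∑ y, g y * ∑ z, c y z * (g y - g z) = ∑ y, ∑ z, c y z * (g y - g z) ^ 2 := by
    rw [two_mul]
    nth_rewrite 1 [h1]
    rw [h1, h2]
    nth_rewrite 1 [← h2]
    simp only [← Finset.sum_add_distrib]
    refine Finset.sum_congr rfl fun y _ => Finset.sum_congr rfl fun z _ => ?_
    ring
  have h0 : ∀ y z, 0 ≤ c y z * (g y - g z) ^ 2 := fun y z => mul_nonneg (hc y z) (sq_nonneg _)
  rw [h3]
  exact (Finset.single_le_sum (fun z _ => h0 a z) (Finset.mem_univ b)).trans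
    (Finset.single_le_sum (f := fun y => ∑ z, c y z * (g y - g z) ^ 2)
      (fun y _ => Finset.sum_nonneg fun z _ => h0 y z) (Finset.mem_univ a))

omit [Fintype S] [DecidableEq S] in
theorem JoinedIn.reflTransGen {q : S → S → ℝ} {G : Set S} {x y : S} (h : JoinedIn q G x y) :
    Relation.ReflTransGen (fun a b => a ∈ G ∧ b ∈ G ∧ 0 < q a b) x y := by
  obtain ⟨ω, hhead, hlast, hpath, hG⟩ := h
  induction ω generalizing x with
  | nil => simp at hhead
  | cons a l ih =>
    obtain rfl : a = x := by simpa using hhead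
    cases l with
    | nil =>
      obtain rfl : a = y := by simpa using hlast
      exact Relation.ReflTransGen.refl
    | cons b l =>
      have hp := List.isChain_cons_cons.1 hpath
      refine Relation.ReflTransGen.head ⟨hG a (by simp), hG b (by simp), hp.1⟩ ?_
      exact ih rfl (by simpa using hlast) hp.2 fun z hz => hG z (List.mem_cons_of_mem _ hz)

omit [DecidableEq S] in
/-- On a connected set, increments of a function are controlled by its increments along edges. -/
theorem exists_sub_le_mul (q : S → S → ℝ) (A : Set S) (hA : IsConnectedSet q A) (x' : S)
    (hx' : x' ∈ A) :
    ∃ L : ℝ, 0 < L ∧ ∀ (g : S → ℝ) (s : ℝ), 0 ≤ s →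
      (∀ a ∈ A, ∀ b ∈ A, 0 < q a b → |g a - g b| ≤ s) → ∀ y ∈ A, g y - g x' ≤ L * s := by
  have hy : ∀ y : S, ∃ L : ℝ, 0 ≤ L ∧ (y ∈ A → ∀ (g : S → ℝ) (s : ℝ), 0 ≤ s →
      (∀ a ∈ A, ∀ b ∈ A, 0 < q a b → |g a - g b| ≤ s) → g y - g x' ≤ L * s) := by
    intro y
    by_cases hyA : y ∈ A
    · have h := (hA x' hx' y hyA).reflTransGen
      clear hyA
      induction h with
      | refl => exact ⟨0, le_rfl, fun _ g s _ _ => by simp⟩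
      | tail _ hbc ih =>
        rename_i b c _
        obtain ⟨L, hL0, hL⟩ := ih
        refine ⟨L + 1, by linarith, fun _ g s hs hg => ?_⟩
        have h1 := hL hbc.1 g s hs hg
        have h2 := abs_le.1 (hg b hbc.1 c hbc.2.1 hbc.2.2)
        linarith [h2.1]
    · exact ⟨0, le_rfl, fun h => absurd h hyA⟩
  choose L hL0 hL using hy
  have hsum : 0 ≤ ∑ y, L y := Finset.sum_nonneg fun y _ => hL0 y
  refine ⟨∑ y, L y + 1, by linarith, fun g s hs hg y hyA => ?_⟩
  refine (hL y hyA g s hs hg).trans (mul_le_mul_of_nonneg_right ?_ hs)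
  linarith [Finset.single_le_sum (fun y _ => hL0 y) (Finset.mem_univ y)]

omit [DecidableEq S] in
theorem exists_pos_le_of_pos (q : S → S → ℝ) : ∃ κ : ℝ, 0 < κ ∧ ∀ a b, 0 < q a b → κ ≤ q a b := by
  classical
  set T := (Finset.univ : Finset (S × S)).filter fun p => 0 < q p.1 p.2
  by_cases hT : T.Nonempty
  · obtain ⟨p, hp, hmin⟩ := T.exists_min_image (fun p => q p.1 p.2) hT
    exact ⟨q p.1 p.2, (Finset.mem_filter.1 hp).2, fun a b hab => hmin (a, b) (by simp [T, hab])⟩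
  · refine ⟨1, one_pos, fun a b hab => absurd ⟨(a, b), by simp [T, hab]⟩ hT⟩

/-- The Green function of the Metropolis chain killed outside `A \ {x'}`. -/
theorem exists_green_le (H : S → ℝ) (q : S → S → ℝ) (hq : ∀ x y : S, 0 ≤ q x y)
    (hsum : ∀ x : S, ∑ y ∈ Finset.univ.erase x, q x y ≤ 1) (hsym : ∀ x y : S, q x y = q y x)
    (A : Set S) (hA : IsConnectedSet q A) (M : ℝ) (hM : ∀ y ∈ A, H y ≤ M) (x x' : S)
    (hx : x ∈ A) (hx' : x' ∈ A) (hxx' : x ≠ x') :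
    ∃ K : ℝ, 0 < K ∧ ∀ β : ℝ, 0 ≤ β → ∀ (n : ℕ), ∀ y ∈ A,
      green (killed (pMet H q β) (A \ {x'})) n x y ≤ K * Real.exp (β * (M - H y)) := by
  obtain ⟨L, hL0, hL⟩ := exists_sub_le_mul q A hA x' hx'
  obtain ⟨κ, hκ0, hκ⟩ := exists_pos_le_of_pos q
  refine ⟨2 * L ^ 2 / κ, by positivity, fun β hβ n y hy => ?_⟩
  have hp := pMet_nonneg (H := H) hβ hq hsum
  set Q := killed (pMet H q β) (A \ {x'}) with hQdef
  have hQ : ∀ a b, 0 ≤ Q a b := killed_nonneg hp _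
  set μ : S → ℝ := fun z => Real.exp (-(β * H z)) with hμ
  have hμ0 : ∀ z, 0 < μ z := fun z => Real.exp_pos _
  set g : S → ℝ := fun z => green Q n x z / μ z with hg
  have hμg : ∀ z, μ z * g z = green Q n x z := fun z => mul_div_cancel₀ _ (hμ0 z).ne'
  have hg0 : ∀ z, 0 ≤ g z := fun z => div_nonneg (green_nonneg hQ n x z) (hμ0 z).le
  have hxB : x ∈ A \ {x'} := ⟨hx, hxx'⟩
  have hgB : ∀ z, z ∉ A \ {x'} → g z = 0 := fun z hz => by
    simp [hg, hQdef, green_killed_eq_zero _ n hxB hz]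
  set c : S → S → ℝ := fun a b => μ a * pMet H q β a b with hc
  have hcsym : ∀ a b, c a b = c b a := exp_mul_pMet_comm H q β hsym
  have hlap : ∀ a ∈ A \ {x'}, ∑ b, c a b * (g a - g b) ≤ (1 : Matrix S S ℝ) x a := by
    intro a ha
    have h1 : ∑ b, c a b * g a = green Q n x a := by
      rw [← hμg a, ← Finset.sum_mul, hc, ← Finset.mul_sum, sum_pMet, mul_one]
    have h2 : ∑ b, c a b * g b = (green Q n * Q) x a := by
      rw [Matrix.mul_apply]
      refine Finset.sum_congr rfl fun b _ => ?_
      rw [hcsym, ← hμg b]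
      by_cases hb : b ∈ A \ {x'}
      · have : Q b a = pMet H q β b a := by
          rw [hQdef, killed, Matrix.of_apply, if_pos ⟨hb, ha⟩]
        rw [this, hc]; ring
      · rw [hgB b hb]; ring
    have h3 := congrFun (congrFun (green_mul_add_one Q n) x) a
    rw [Matrix.add_apply, Matrix.add_apply] at h3
    simp only [mul_sub, Finset.sum_sub_distrib]
    rw [h1, h2]
    linarith [pow_apply_nonneg hQ n x a]
  have hE : ∑ a, g a * ∑ b, c a b * (g a - g b) ≤ g x := by
    calc ∑ a, g a * ∑ b, c a b * (g a - g b) ≤ ∑ a, g a * (1 : Matrix S S ℝ) x a := by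
          refine Finset.sum_le_sum fun a _ => ?_
          by_cases ha : a ∈ A \ {x'}
          · exact mul_le_mul_of_nonneg_left (hlap a ha) (hg0 a)
          · simp [hgB a ha]
      _ = g x := by simp [Matrix.one_apply]
  set W := Real.exp (β * M) with hW
  have hW0 : 0 < W := Real.exp_pos _
  have hedge : ∀ a ∈ A, ∀ b ∈ A, 0 < q a b → |g a - g b| ≤ Real.sqrt (2 * W / κ * g x) := by
    intro a ha b hb hab
    by_cases hne : a = b
    · simp [hne]
    refine Real.abs_le_sqrt ?_
    have h1 := conductance_mul_sq_le c (fun a b => mul_nonneg (hμ0 a).le (hp a b)) hcsym g a b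
    have h2 : κ / W ≤ c a b := by
      have : c a b = q a b * Real.exp (-(β * max (H a) (H b))) := exp_mul_pMet H q β hne
      rw [this, div_eq_mul_inv, hW, ← Real.exp_neg]
      refine mul_le_mul (hκ a b hab) (Real.exp_le_exp.2 ?_) (Real.exp_pos _).le (hq a b)
      exact neg_le_neg (mul_le_mul_of_nonneg_left (max_le (hM a ha) (hM b hb)) hβ)
    have h3 : κ / W * (g a - g b) ^ 2 ≤ 2 * g x :=
      (mul_le_mul_of_nonneg_right h2 (sq_nonneg _)).trans (by linarith)
    rw [div_mul_eq_mul_div, div_le_iff₀ hW0] at h3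
    rw [div_mul_eq_mul_div, le_div_iff₀ hκ0]
    linarith
  have hgx' : g x' = 0 := hgB x' (by simp)
  set s := Real.sqrt (2 * W / κ * g x) with hs
  have hs0 : 0 ≤ s := Real.sqrt_nonneg _
  have hs2 : s ^ 2 = 2 * W / κ * g x :=
    Real.sq_sqrt (mul_nonneg (by positivity) (hg0 x))
  have hle : ∀ z ∈ A, g z ≤ L * s := fun z hz => by
    simpa [hgx'] using hL g s hs0 hedge z hz
  have hsle : s ≤ 2 * W / κ * L := by
    rcases hs0.eq_or_lt with h | h
    · rw [← h]; positivity
    · have h1 : s ^ 2 ≤ 2 * W / κ * (L * s) := by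
        rw [hs2]; exact mul_le_mul_of_nonneg_left (hle x hx) (by positivity)
      refine le_of_mul_le_mul_right ?_ h
      nlinarith
  have hgy : g y ≤ 2 * L ^ 2 / κ * W := by
    refine (hle y hy).trans ((mul_le_mul_of_nonneg_left hsle hL0.le).trans (le_of_eq ?_))
    ring
  calc green Q n x y = μ y * g y := (hμg y).symm
    _ ≤ μ y * (2 * L ^ 2 / κ * W) := mul_le_mul_of_nonneg_left hgy (hμ0 y).le
    _ = 2 * L ^ 2 / κ * Real.exp (β * (M - H y)) := by
      rw [mul_left_comm, hμ, hW, ← Real.exp_add]; ring_nf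

omit [Fintype S] [DecidableEq S] in
theorem visitsBefore_cons_iff {a x : S} {D : Set S} (hxa : x ≠ a) (hxD : x ∉ D) (N : ℕ) {n : ℕ}
    (y : S) (f : Fin n → S) :
    VisitsBefore a D (N + 1) (trajFun x (Fin.cons y f : Fin (n + 1) → S)) ↔
      VisitsBefore a D N (trajFun y f) := by
  constructor
  · rintro ⟨t, ht, hta, hD⟩
    cases t with
    | zero => rw [trajFun_zero] at hta; exact absurd hta hxa
    | succ t =>
      rw [trajFun_cons_succ] at hta
      refine ⟨t, by omega, hta, fun s hs => ?_⟩
      have := hD (s + 1) (by omega)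
      rwa [trajFun_cons_succ] at this
  · rintro ⟨t, ht, hta, hD⟩
    refine ⟨t + 1, by omega, by rwa [trajFun_cons_succ], fun s hs => ?_⟩
    cases s with
    | zero => rwa [trajFun_zero]
    | succ s => rw [trajFun_cons_succ]; exact hD s (by omega)

theorem ProbX_visitsBefore_self (H : S → ℝ) (q : S → S → ℝ) (β : ℝ) {a : S} {D : Set S}
    (haD : a ∉ D) (n N : ℕ) : ProbX H q β a n (VisitsBefore a D (N + 1)) = 1 := by
  rw [← ProbX_true H q β a n]
  refine ProbX_congr _ _ _ _ _ fun f => iff_true_intro ⟨0, by omega, trajFun_zero a f, ?_⟩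
  intro s hs
  obtain rfl : s = 0 := by omega
  rwa [trajFun_zero]

open scoped Classical in
/-- The probability of failing to visit `x'` inside `A` before time `n + 1` is at most the
expected number of jumps out of `A` plus the probability of surviving in `A \ {x'}`. -/
theorem one_sub_ProbX_le (H : S → ℝ) (q : S → S → ℝ) (β : ℝ) (hp : ∀ x y, 0 ≤ pMet H q β x y)
    (A : Set S) (x' : S) (hx' : x' ∈ A) (n : ℕ) (x : S) (hx : x ∈ A \ {x'}) :
    1 - ProbX H q β x (n + 1) (VisitsBefore x' (extBoundary q A) (n + 1)) ≤
      ∑ y, green (killed (pMet H q β) (A \ {x'})) n x y *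
          (∑ z, if z ∈ A then 0 else pMet H q β y z) +
        ∑ y, (killed (pMet H q β) (A \ {x'}) ^ n) x y := by
  set Q := killed (pMet H q β) (A \ {x'}) with hQdef
  set r : S → ℝ := fun y => ∑ z, if z ∈ A then 0 else pMet H q β y z with hr
  set u : ℕ → S → ℝ := fun n x =>
    1 - ProbX H q β x (n + 1) (VisitsBefore x' (extBoundary q A) (n + 1)) with hu
  have hnot : ∀ y ∈ A, y ∉ extBoundary q A := fun y hy h => h.1 hy
  have hu1 : ∀ n y, u n y ≤ 1 := fun n y => by
    simp only [hu]; linarith [ProbX_nonneg hp y (n + 1) (VisitsBefore x' (extBoundary q A) (n + 1))]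
  have hux' : ∀ n, u n x' = 0 := fun n => by
    simp only [hu]; rw [ProbX_visitsBefore_self H q β (hnot x' hx')]; ring
  change u n x ≤ ∑ y, green Q n x y * r y + ∑ y, (Q ^ n) x y
  induction n generalizing x with
  | zero =>
    have h1 : ∑ y, ((Q ^ 0) x y) = 1 := by simp [Matrix.one_apply]
    rw [h1]
    simpa [green] using hu1 0 x
  | succ n ih =>
    have hstep : u (n + 1) x = ∑ y, pMet H q β x y * u n y := by
      simp only [hu, mul_sub, mul_one, Finset.sum_sub_distrib, sum_pMet]
      rw [ProbX_succ H q β x (n + 1) _ (VisitsBefore x' (extBoundary q A) (n + 1))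
        fun y f => visitsBefore_cons_iff hx.2 (hnot x hx.1) (n + 1) y f]
    have hterm : ∀ y, pMet H q β x y * u n y ≤
        Q x y * (∑ z, green Q n y z * r z + ∑ z, (Q ^ n) y z) +
          (if y ∈ A then 0 else pMet H q β x y) := by
      intro y
      by_cases hyA : y ∈ A
      · by_cases hyx : y = x'
        · have : Q x y = 0 := by simp [hQdef, killed, hyx]
          rw [this, if_pos hyA, hyx, hux']; simp
        · have hy : y ∈ A \ {x'} := ⟨hyA, hyx⟩
          have : Q x y = pMet H q β x y := by
            rw [hQdef, killed, Matrix.of_apply, if_pos ⟨hx, hy⟩]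
          rw [this, if_pos hyA, add_zero]
          exact mul_le_mul_of_nonneg_left (ih y hy) (hp x y)
      · have : Q x y = 0 := by simp [hQdef, killed, hyA]
        rw [this, if_neg hyA, zero_mul, zero_add]
        exact mul_le_of_le_one_right (hp x y) (hu1 n y)
    rw [hstep]
    refine (Finset.sum_le_sum fun y _ => hterm y).trans (le_of_eq ?_)
    rw [Finset.sum_add_distrib]
    simp only [mul_add, Finset.sum_add_distrib]
    have h1 : ∑ y, green Q (n + 1) x y * r y =
        ∑ y, Q x y * ∑ z, green Q n y z * r z + r x := by
      simp only [green_succ_eq, Matrix.add_apply, Matrix.mul_apply, add_mul,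
        Finset.sum_add_distrib, Finset.sum_mul, Finset.mul_sum]
      rw [Finset.sum_comm]
      simp [Matrix.one_apply, mul_assoc]
    have h2 : ∑ y, (Q ^ (n + 1)) x y = ∑ y, Q x y * ∑ z, (Q ^ n) y z := by
      simp only [pow_succ', Matrix.mul_apply, Finset.mul_sum]
      exact Finset.sum_comm
    rw [h1, h2]
    simp only [hr]
    ring

omit [DecidableEq S] in
theorem exists_gap (H : S → ℝ) (q : S → S → ℝ) (A : Set S) (M : ℝ)
    (hM : ∀ y ∈ extBoundary q A, M < H y) :
    ∃ δ : ℝ, 0 < δ ∧ ∀ y ∈ extBoundary q A, M + δ ≤ H y := by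
  by_cases hne : (extBoundary q A).Nonempty
  · obtain ⟨z, hz, hmin⟩ := Set.exists_min_image _ H (Set.toFinite (extBoundary q A)) hne
    exact ⟨H z - M, sub_pos.2 (hM z hz), fun y hy => by linarith [hmin y hy]⟩
  · exact ⟨1, one_pos, fun y hy => absurd ⟨y, hy⟩ hne⟩

open scoped Classical in
theorem exp_mul_exit_le (H : S → ℝ) (q : S → S → ℝ) (hq : ∀ x y : S, 0 ≤ q x y ∧ q x y ≤ 1)
    (A : Set S) (M δ β : ℝ) (hβ : 0 ≤ β)
    (hδ : ∀ y ∈ extBoundary q A, M + δ ≤ H y) (y : S) (hy : y ∈ A) :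
    Real.exp (β * (M - H y)) * (∑ z, if z ∈ A then 0 else pMet H q β y z) ≤
      Fintype.card S * Real.exp (-(β * δ)) := by
  rw [Finset.mul_sum]
  refine (Finset.sum_le_card_nsmul _ _ (Real.exp (-(β * δ))) fun z _ => ?_).trans
    (le_of_eq (by simp))
  by_cases hz : z ∈ A
  · simp [hz, (Real.exp_pos _).le]
  have hyz : y ≠ z := fun h => hz (h ▸ hy)
  rw [if_neg hz, pMet, if_neg hyz]
  rcases (hq y z).1.eq_or_lt with h0 | h0
  · rw [← h0]; simp [(Real.exp_pos _).le]
  · have hzb := hδ z ⟨hz, y, hy, h0⟩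
    rw [mul_left_comm, ← Real.exp_add]
    refine (mul_le_of_le_one_left (Real.exp_pos _).le (hq y z).2).trans (Real.exp_le_exp.2 ?_)
    have h1 := mul_le_mul_of_nonneg_left (le_max_left (H z - H y) 0) hβ
    have h2 := mul_le_mul_of_nonneg_left hzb hβ
    nlinarith

omit [DecidableEq S] in
theorem sum_killed_le_one {P : S → S → ℝ} (hP : ∀ x y, 0 ≤ P x y) (hP1 : ∀ x, ∑ y, P x y = 1)
    (B : Set S) (x : S) : ∑ y, killed P B x y ≤ 1 := by
  rw [← hP1 x]
  refine Finset.sum_le_sum fun y _ => ?_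
  simp only [killed, Matrix.of_apply]
  split_ifs
  · exact le_rfl
  · exact hP x y

/-- Exponential bound on the probability of not visiting `x'` in time before leaving `A`. -/
theorem exists_one_sub_ProbX_le (H : S → ℝ) (q : S → S → ℝ)
    (hq : ∀ x y : S, 0 ≤ q x y ∧ q x y ≤ 1)
    (hsum : ∀ x : S, ∑ y ∈ Finset.univ.erase x, q x y ≤ 1)
    (hsym : ∀ x y : S, q x y = q y x)
    (A : Set S) (hA : IsConnectedSet q A) (M m δ ε : ℝ) (hM : ∀ y ∈ A, H y ≤ M)
    (hm : ∀ y ∈ A, m ≤ H y) (hδ : ∀ y ∈ extBoundary q A, M + δ ≤ H y)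
    (x x' : S) (hx : x ∈ A) (hx' : x' ∈ A) (hxx' : x ≠ x') :
    ∃ C : ℝ, ∀ β : ℝ, 0 ≤ β →
      1 - ProbX H q β x ⌈Real.exp (β * (M - m + ε))⌉₊
          (VisitsBefore x' (extBoundary q A) ⌈Real.exp (β * (M - m + ε))⌉₊) ≤
        C * (Real.exp (-(β * δ)) + Real.exp (-(β * ε))) := by
  classical
  obtain ⟨K, hK0, hK⟩ :=
    exists_green_le H q (fun x y => (hq x y).1) hsum hsym A hA M hM x x' hx hx' hxx'
  set N := (Fintype.card S : ℝ) with hN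
  have hN1 : 1 ≤ N := by
    have : 0 < Fintype.card S := Fintype.card_pos_iff.2 ⟨x⟩
    rw [hN]; exact_mod_cast this
  refine ⟨N * (K * N), fun β hβ => ?_⟩
  have hp := pMet_nonneg (H := H) hβ (fun x y => (hq x y).1) hsum
  obtain ⟨n, hn⟩ : ∃ n, ⌈Real.exp (β * (M - m + ε))⌉₊ = n + 1 :=
    Nat.exists_eq_succ_of_ne_zero (Nat.ceil_pos.2 (Real.exp_pos _)).ne'
  have hnexp : Real.exp (β * (M - m + ε)) ≤ (n : ℝ) + 1 := by
    have := Nat.le_ceil (Real.exp (β * (M - m + ε)))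
    rw [hn] at this
    exact_mod_cast this
  rw [hn]
  have hxB : x ∈ A \ {x'} := ⟨hx, hxx'⟩
  refine (one_sub_ProbX_le H q β hp A x' hx' n x hxB).trans ?_
  have hQ := killed_nonneg hp (A \ {x'})
  rw [mul_add]
  refine add_le_add ?_ ?_
  · refine (Finset.sum_le_card_nsmul _ _ (K * N * Real.exp (-(β * δ))) fun y _ => ?_).trans
      (le_of_eq (by rw [Finset.card_univ, nsmul_eq_mul]; ring))
    by_cases hy : y ∈ A
    · have hr0 : 0 ≤ ∑ z, if z ∈ A then 0 else pMet H q β y z :=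
        Finset.sum_nonneg fun z _ => by split_ifs; exacts [le_rfl, hp y z]
      refine (mul_le_mul_of_nonneg_right (hK β hβ n y hy) hr0).trans ?_
      rw [mul_assoc, mul_assoc]
      exact mul_le_mul_of_nonneg_left (exp_mul_exit_le H q hq A M δ β hβ hδ y hy) hK0.le
    · rw [green_killed_eq_zero _ n hxB fun h => hy h.1, zero_mul]
      positivity
  · have h1 := mul_sum_pow_le_sum_green hQ (sum_killed_le_one hp (sum_pMet H q β) _) n x
    have h2 : ∑ y, green (killed (pMet H q β) (A \ {x'})) (n + 1) x y ≤
        N * (K * Real.exp (β * (M - m))) := by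
      refine (Finset.sum_le_card_nsmul _ _ (K * Real.exp (β * (M - m))) fun y _ => ?_).trans
        (le_of_eq (by rw [Finset.card_univ, nsmul_eq_mul]))
      by_cases hy : y ∈ A
      · refine (hK β hβ (n + 1) y hy).trans ?_
        have := hm y hy
        gcongr
      · rw [green_killed_eq_zero _ (n + 1) hxB fun h => hy h.1]
        positivity
    set s := ∑ y, (killed (pMet H q β) (A \ {x'}) ^ n) x y
    have hs0 : 0 ≤ s := Finset.sum_nonneg fun y _ => pow_apply_nonneg hQ n x y
    have h3 : Real.exp (β * (M - m + ε)) * s ≤ N * (K * Real.exp (β * (M - m))) :=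
      (mul_le_mul_of_nonneg_right hnexp hs0).trans (h1.trans h2)
    have h4 : s ≤ N * K * Real.exp (-(β * ε)) := by
      refine le_of_mul_le_mul_left ?_ (Real.exp_pos (β * (M - m + ε)))
      refine h3.trans (le_of_eq ?_)
      have : Real.exp (β * (M - m)) =
          Real.exp (β * (M - m + ε)) * Real.exp (-(β * ε)) := by
        rw [← Real.exp_add]; ring_nf
      rw [this]; ring
    refine h4.trans (mul_le_mul_of_nonneg_right ?_ (Real.exp_pos _).le)
    exact mul_le_mul_of_nonneg_left (le_mul_of_one_le_right hK0.le hN1) (by linarith)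

/-- Inside a non-trivial path cycle: with probability tending to `1` as `β → ∞`, the chain
started at `x ∈ A` visits `x' ∈ A` before exiting `A` and within time `exp(β(Γ̃(A)+ε))`. -/
theorem visit_pathCycle (H : S → ℝ) (q : S → S → ℝ)
    (hq : ∀ x y : S, 0 ≤ q x y ∧ q x y ≤ 1)
    (hsum : ∀ x : S, ∑ y ∈ Finset.univ.erase x, q x y ≤ 1)
    (hsym : ∀ x y : S, q x y = q y x)
    (hirr : ∀ x y : S, JoinedIn q Set.univ x y)
    (A : Set S) (hA : IsNontrivialPathCycle H q A) (ε : ℝ) (hε : 0 < ε)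
    (x x' : S) (hx : x ∈ A) (hx' : x' ∈ A) :
    Filter.Tendsto (fun β : ℝ =>
        ProbX H q β x ⌈Real.exp (β * (cycleRes H A + ε))⌉₊ (fun ω =>
          hitTime ({x'} : Set S) ω < hitTime (extBoundary q A) ω ∧
          ∃ t : ℕ, hitTime ({x'} : Set S) ω = (t : ℕ∞) ∧
              (t : ℝ) < Real.exp (β * (cycleRes H A + ε))))
      Filter.atTop (nhds 1) := by
  classical
  simp only [hitTime_event_iff]
  have hfin : (H '' A).Finite := Set.toFinite _
  by_cases hxx' : x = x'
  · subst hxx'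
    refine tendsto_const_nhds.congr fun β => ?_
    obtain ⟨n, hn⟩ : ∃ n, ⌈Real.exp (β * (cycleRes H A + ε))⌉₊ = n + 1 :=
      Nat.exists_eq_succ_of_ne_zero (Nat.ceil_pos.2 (Real.exp_pos _)).ne'
    rw [hn, ProbX_visitsBefore_self H q β fun h => h.1 hx]
  have hMle : ∀ y ∈ A, H y ≤ sSup (H '' A) := fun y hy =>
    le_csSup hfin.bddAbove (Set.mem_image_of_mem H hy)
  have hmle : ∀ y ∈ A, sInf (H '' A) ≤ H y := fun y hy =>
    csInf_le hfin.bddBelow (Set.mem_image_of_mem H hy)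
  obtain ⟨w, hw, hwM⟩ : sSup (H '' A) ∈ H '' A := (hA.1.image H).csSup_mem hfin
  obtain ⟨δ, hδ0, hδ⟩ := exists_gap H q A (sSup (H '' A)) fun y hy => by
    rw [← hwM]; exact hA.2.2 w hw y hy
  obtain ⟨C, hC⟩ := exists_one_sub_ProbX_le H q hq hsum hsym A hA.2.1 _ _ δ ε hMle hmle hδ
    x x' hx hx' hxx'
  have hexp : ∀ a : ℝ, 0 < a →
      Filter.Tendsto (fun β : ℝ => Real.exp (-(β * a))) Filter.atTop (nhds 0) := fun a ha =>
    Real.tendsto_exp_neg_atTop_nhds_zero.comp (Filter.tendsto_id.atTop_mul_const ha)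
  have hlim : Filter.Tendsto
      (fun β : ℝ => 1 - C * (Real.exp (-(β * δ)) + Real.exp (-(β * ε))))
      Filter.atTop (nhds 1) := by
    simpa using (((hexp δ hδ0).add (hexp ε hε)).const_mul C).const_sub 1
  refine tendsto_of_tendsto_of_tendsto_of_le_of_le' hlim tendsto_const_nhds ?_ ?_
  · filter_upwards [Filter.eventually_ge_atTop 0] with β hβ
    have := hC β hβ
    unfold cycleRes
    linarith
  · filter_upwards [Filter.eventually_ge_atTop 0] with β hβ
    exact ProbX_le_one (pMet_nonneg hβ (fun x y => (hq x y).1) hsum) _ _ _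

end MetropolisCycles
end
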